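/- Suppose ρ > 0. There exists a constant C > 0 such that for arbitrary n ≥ 1, arbitrary real numbers A_1, …, A_n, and all t > 0, |∫_ℝ e^{iβt} ∏_{k=1}^n (1 − i(A_k − β))^{−ρ} dβ| ≤ C^n t^{nρ−1} e^{−t} / ((n−1)!)^ρ. -/

import Mathlib

open MeasureTheory

namespace ProbabilityTheory

lemma integrable_gammaPDFReal {a r : ℝ} (ha : 0 < a) (hr : 0 < r) :
    Integrable (gammaPDFReal a r) := by
  refine ⟨by fun_prop, ?_⟩
  rw [hasFiniteIntegral_iff_ofReal (ae_of_all _ (gammaPDFReal_nonneg ha hr))]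
  exact (lintegral_gammaPDF_eq_one ha hr).trans_lt ENNReal.one_lt_top

lemma integral_gammaPDFReal {a r : ℝ} (ha : 0 < a) (hr : 0 < r) :
    ∫ x, gammaPDFReal a r x = 1 := by
  rw [integral_eq_lintegral_of_nonneg_ae (ae_of_all _ (gammaPDFReal_nonneg ha hr)) (by fun_prop)]
  exact congrArg ENNReal.toReal (lintegral_gammaPDF_eq_one ha hr)

lemma gammaPDFReal_mul_exp {r t : ℝ} (a : ℝ) (hr : 0 < r) (ht : t < r) (x : ℝ) :
    gammaPDFReal a r x * Real.exp (t * x) = (1 - t / r) ^ (-a) * gammaPDFReal a (r - t) x := by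
  have h : r ^ a = (1 - t / r) ^ (-a) * (r - t) ^ a := by
    have hr' : 0 ≤ r - t := by linarith
    rw [one_sub_div hr.ne', Real.div_rpow hr' hr.le, Real.rpow_neg hr', Real.rpow_neg hr.le]
    have := Real.rpow_pos_of_pos (sub_pos.2 ht) a
    field_simp
  have he : Real.exp (-((r - t) * x)) = Real.exp (-(r * x)) * Real.exp (t * x) := by
    rw [← Real.exp_add]; ring_nf
  unfold gammaPDFReal
  split_ifs
  · rw [he, h]; ring
  · simp

lemma measurable_gammaPDF (a r : ℝ) : Measurable (gammaPDF a r) :=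
  (measurable_gammaPDFReal a r).ennreal_ofReal

lemma integrable_gammaMeasure_iff {E : Type*} [NormedAddCommGroup E] [NormedSpace ℝ E]
    {a r : ℝ} (ha : 0 < a) (hr : 0 < r) (f : ℝ → E) :
    Integrable f (gammaMeasure a r) ↔ Integrable (fun x ↦ gammaPDFReal a r x • f x) := by
  rw [gammaMeasure, integrable_withDensity_iff_integrable_smul'
    (measurable_gammaPDF a r) (ae_of_all _ fun _ ↦ ENNReal.ofReal_lt_top)]
  simp [gammaPDF, ENNReal.toReal_ofReal (gammaPDFReal_nonneg ha hr _)]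

lemma integral_gammaMeasure {E : Type*} [NormedAddCommGroup E] [NormedSpace ℝ E]
    {a r : ℝ} (ha : 0 < a) (hr : 0 < r) (f : ℝ → E) :
    ∫ x, f x ∂gammaMeasure a r = ∫ x, gammaPDFReal a r x • f x := by
  rw [gammaMeasure, integral_withDensity_eq_integral_toReal_smul
    (measurable_gammaPDF a r) (ae_of_all _ fun _ ↦ ENNReal.ofReal_lt_top)]
  simp [gammaPDF, ENNReal.toReal_ofReal (gammaPDFReal_nonneg ha hr _)]

lemma mgf_gammaMeasure {a r t : ℝ} (ha : 0 < a) (hr : 0 < r) (ht : t < r) :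
    mgf id (gammaMeasure a r) t = (1 - t / r) ^ (-a) := by
  simp_rw [mgf, integral_gammaMeasure ha hr, smul_eq_mul, id, gammaPDFReal_mul_exp a hr ht,
    integral_const_mul, integral_gammaPDFReal ha (sub_pos.2 ht), mul_one]

lemma Iio_subset_integrableExpSet_gammaMeasure {a r : ℝ} (ha : 0 < a) (hr : 0 < r) :
    Set.Iio r ⊆ integrableExpSet id (gammaMeasure a r) := by
  intro t ht
  simp_rw [integrableExpSet, Set.mem_ofPred_eq, integrable_gammaMeasure_iff ha hr, smul_eq_mul, id,
    gammaPDFReal_mul_exp a hr ht]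
  exact (integrable_gammaPDFReal ha (sub_pos.2 ht)).const_mul _

/-- The complex moment generating function of the gamma distribution of rate one. -/
lemma complexMGF_gammaMeasure_one {a : ℝ} (ha : 0 < a) {z : ℂ} (hz : z.re < 1) :
    complexMGF id (gammaMeasure a 1) z = (1 - z) ^ (-(a : ℂ)) := by
  have hU : IsOpen {z : ℂ | z.re < 1} := isOpen_lt Complex.continuous_re continuous_const
  have hf : AnalyticOnNhd ℂ (complexMGF id (gammaMeasure a 1)) {z : ℂ | z.re < 1} :=
    analyticOnNhd_complexMGF.mono fun w hw ↦
      interior_maximal (Iio_subset_integrableExpSet_gammaMeasure ha one_pos) isOpen_Iio hw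
  have hg : AnalyticOnNhd ℂ (fun z : ℂ ↦ (1 - z) ^ (-(a : ℂ))) {z : ℂ | z.re < 1} := by
    refine DifferentiableOn.analyticOnNhd (fun w hw ↦ ?_) hU
    refine ((differentiableAt_const _).sub differentiableAt_id).cpow_const ?_
      |>.differentiableWithinAt
    exact Or.inl (by simpa using hw)
  refine hf.eqOn_of_preconnected_of_frequently_eq hg
    (convex_halfSpace_re_lt 1).isPreconnected (z₀ := 0) (by simp) ?_ hz
  have hlim : Filter.Tendsto (fun t : ℝ ↦ (t : ℂ)) (nhdsWithin 0 {0}ᶜ)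
      (nhdsWithin 0 {0}ᶜ) := by
    refine tendsto_nhdsWithin_of_tendsto_nhds_of_eventually_within _ ?_ ?_
    · exact (Complex.continuous_ofReal.tendsto' 0 0 (by simp)).mono_left nhdsWithin_le_nhds
    · filter_upwards [self_mem_nhdsWithin] with t ht using by simpa using ht
  refine hlim.frequently (Filter.Eventually.frequently ?_)
  filter_upwards [nhdsWithin_le_nhds (Iio_mem_nhds one_pos)] with t ht
  rw [complexMGF_ofReal, mgf_gammaMeasure ha one_pos ht, div_one,
    Complex.ofReal_cpow (by linarith [Set.mem_Iio.1 ht])]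
  simp

lemma charFun_gammaMeasure_one {a : ℝ} (ha : 0 < a) (t : ℝ) :
    charFun (gammaMeasure a 1) t = (1 - Complex.I * t) ^ (-(a : ℂ)) := by
  rw [← complexMGF_id_mul_I, complexMGF_gammaMeasure_one ha (by simp), mul_comm]

/-- A sum of independent gamma variables of rate one is a gamma variable. -/
lemma map_sum_pi_gammaMeasure_one {ι : Type*} [Fintype ι] [Nonempty ι] {a : ℝ} (ha : 0 < a) :
    (Measure.pi fun _ : ι ↦ gammaMeasure a 1).map (fun x ↦ ∑ i, x i) =
      gammaMeasure (Fintype.card ι * a) 1 := by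
  have hb : 0 < Fintype.card ι * a := by positivity
  have := isProbabilityMeasure_gammaMeasure ha one_pos
  have := isProbabilityMeasure_gammaMeasure hb one_pos
  refine Measure.ext_of_charFun (funext fun t ↦ ?_)
  have hexp (x : ι → ℝ) : Complex.exp (t * ↑(∑ i, x i) * Complex.I) =
      ∏ i, Complex.exp (t * x i * Complex.I) := by
    rw [← Complex.exp_sum, Complex.ofReal_sum, Finset.mul_sum, Finset.sum_mul]
  rw [charFun_apply_real, integral_map (by fun_prop) (by fun_prop)]
  simp_rw [hexp]
  rw [integral_fintype_prod_eq_prod (fun _ (x : ℝ) ↦ Complex.exp (t * x * Complex.I))]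
  simp_rw [← charFun_apply_real, charFun_gammaMeasure_one ha, charFun_gammaMeasure_one hb,
    Finset.prod_const, Finset.card_univ, ← Complex.cpow_nat_mul]
  push_cast
  ring_nf

end ProbabilityTheory

/-- A lower bound for the Gamma function in the spirit of Stirling's formula. -/
lemma Real.rpow_mul_exp_neg_le_Gamma_add_one {x : ℝ} (hx : 0 < x) :
    x ^ x * Real.exp (-x) ≤ Real.Gamma (x + 1) := by
  have hint := Real.GammaIntegral_convergent (s := x + 1) (by linarith)
  have hsub : Set.Ioi x ⊆ Set.Ioi 0 := Set.Ioi_subset_Ioi hx.le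
  rw [Real.Gamma_eq_integral (by linarith), ← integral_exp_neg_Ioi, ← integral_const_mul]
  calc ∫ s in Set.Ioi x, x ^ x * Real.exp (-s)
      ≤ ∫ s in Set.Ioi x, Real.exp (-s) * s ^ (x + 1 - 1) := by
        refine setIntegral_mono_on ((integrableOn_exp_neg_Ioi x).const_mul _)
          (hint.mono_set hsub) measurableSet_Ioi fun s hs ↦ ?_
        rw [mul_comm, add_sub_cancel_right]
        have : x ≤ s := le_of_lt hs
        gcongr
    _ ≤ _ := by
        refine setIntegral_mono_set hint ?_ hsub.eventuallyLE
        filter_upwards [ae_restrict_mem measurableSet_Ioi] with s hs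
        have : 0 < s := hs
        positivity

lemma Real.factorial_rpow_le_pow_mul_Gamma {ρ : ℝ} (hρ : 0 < ρ) {n : ℕ} (hn : 1 ≤ n) :
    ((n - 1).factorial : ℝ) ^ ρ ≤
      (2 * (1 + ρ) * (Real.exp 1 / ρ) ^ ρ) ^ n * Real.Gamma (n * ρ) := by
  have hn0 : (0 : ℝ) < n := by exact_mod_cast hn
  have hx : 0 < n * ρ := by positivity
  have hfac : ((n - 1).factorial : ℝ) ≤ (n : ℝ) ^ (n : ℝ) := by
    rw [Real.rpow_natCast]
    exact_mod_cast (Nat.factorial_le (Nat.sub_le n 1)).trans (Nat.factorial_le_pow n)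
  have hG := Real.rpow_mul_exp_neg_le_Gamma_add_one hx
  rw [Real.Gamma_add_one hx.ne', Real.mul_rpow hn0.le hρ.le] at hG
  have h2 : (n : ℝ) ≤ 2 ^ n := by exact_mod_cast Nat.lt_two_pow_self.le
  have h3 : ρ ≤ (1 + ρ) ^ n :=
    (by linarith : ρ ≤ 1 + ρ).trans (le_self_pow₀ (by linarith) (by omega))
  have hexp : (Real.exp 1 / ρ) ^ (n * ρ) = Real.exp (n * ρ) / ρ ^ (n * ρ) := by
    rw [Real.div_rpow (Real.exp_pos _).le hρ.le, Real.exp_one_rpow]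
  have hGpos := Real.Gamma_pos_of_pos hx
  calc ((n - 1).factorial : ℝ) ^ ρ ≤ ((n : ℝ) ^ (n : ℝ)) ^ ρ := by gcongr
    _ = (n : ℝ) ^ (n * ρ) := by rw [← Real.rpow_mul hn0.le]
    _ = (n : ℝ) ^ (n * ρ) * ρ ^ (n * ρ) * Real.exp (-(n * ρ)) * (Real.exp 1 / ρ) ^ (n * ρ) := by
        rw [hexp, Real.exp_neg]
        have := Real.rpow_pos_of_pos hρ (n * ρ)
        field_simp
    _ ≤ n * ρ * Real.Gamma (n * ρ) * (Real.exp 1 / ρ) ^ (n * ρ) := by gcongr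
    _ ≤ 2 ^ n * (1 + ρ) ^ n * Real.Gamma (n * ρ) * (Real.exp 1 / ρ) ^ (n * ρ) := by gcongr
    _ = _ := by
        rw [mul_pow, mul_pow, ← Real.rpow_mul_natCast (by positivity), mul_comm (n : ℝ) ρ]
        ring

/-- If `S` has density `g` under `μ` and `g` is continuous at `t`, then the inverse Fourier
transform at `t` of `β ↦ ∫ exp (-iβS) h dμ` with `‖h‖ ≤ 1` is at most `2π g(t)`. -/
lemma norm_integral_exp_mul_le_of_map_eq_withDensity {X : Type*} {mX : MeasurableSpace X}
    {μ : Measure X} [IsFiniteMeasure μ] {S : X → ℝ} {h : X → ℂ} (hS : Measurable S)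
    (hh : Measurable h) (hh1 : ∀ x, ‖h x‖ ≤ 1) {g : ℝ → ℝ} (hg0 : ∀ w, 0 ≤ g w)
    (hgm : Measurable g) (hgi : Integrable g)
    (hmap : μ.map S = volume.withDensity fun w ↦ ENNReal.ofReal (g w)) {t : ℝ}
    (hgt : ContinuousAt g t) :
    ‖∫ β : ℝ, Complex.exp (Complex.I * β * t) *
      ∫ x, Complex.exp (-(Complex.I * β * S x)) * h x ∂μ‖ ≤ 2 * Real.pi * g t := by
  set F : ℝ → ℂ := fun β ↦ Complex.exp (Complex.I * β * t) *
    ∫ x, Complex.exp (-(Complex.I * β * S x)) * h x ∂μ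
  by_cases hF : Integrable F
  swap
  · rw [integral_undef hF, norm_zero]
    have := hg0 t
    positivity
  let K (c u : ℝ) : ℝ := Real.sqrt (Real.pi * c) * Real.exp (-c * u ^ 2 / 4)
  have hK (c u : ℝ) : 0 ≤ K c u := by positivity
  -- Gaussian regularisation and Fubini
  have key (c : ℝ) (hc : 0 < c) :
      ∫ β : ℝ, Complex.exp (-c⁻¹ * ‖β‖ ^ 2) • F β = ∫ x, K c (t - S x) * h x ∂μ := by
    have hF' (β : ℝ) : Complex.exp (-c⁻¹ * ‖β‖ ^ 2) • F β =
        ∫ x, Complex.exp (Complex.I * ↑(t - S x) * β) * Complex.exp (-c⁻¹ * β ^ 2) * h x ∂μ := by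
      simp only [F, smul_eq_mul]
      rw [← mul_assoc, ← integral_const_mul]
      congr 1 with x
      rw [← mul_assoc, ← Complex.exp_add, ← Complex.exp_add, ← Complex.exp_add]
      congr 2
      have : ((‖β‖ : ℝ) : ℂ) ^ 2 = (β : ℂ) ^ 2 := by
        rw [← Complex.ofReal_pow, Real.norm_eq_abs, sq_abs, Complex.ofReal_pow]
      rw [this]
      push_cast
      ring
    simp_rw [hF']
    rw [integral_integral_swap]
    · congr 1 with x
      rw [integral_mul_const, fourierIntegral_gaussian (by simpa using hc)]
      congr 1
      simp only [K]
      rw [Complex.ofReal_mul, Real.sqrt_eq_rpow, Complex.ofReal_cpow (by positivity)]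
      push_cast
      congr 2
      · rw [div_inv_eq_mul]
      · field_simp
    · have hint : Integrable (fun p : ℝ × X ↦ Real.exp (-c⁻¹ * p.1 ^ 2) * (1 : ℝ))
          (volume.prod μ) :=
        (integrable_exp_neg_mul_sq (inv_pos.2 hc)).mul_prod (integrable_const (μ := μ) 1)
      refine hint.mono' (by fun_prop) (ae_of_all _ fun ⟨β, x⟩ ↦ ?_)
      simp only [Function.uncurry, norm_mul, Complex.norm_exp]
      have h1 : (Complex.I * ↑(t - S x) * β).re = 0 := by simp
      have h2 : (-((c⁻¹ : ℝ) : ℂ) * β ^ 2).re = -c⁻¹ * β ^ 2 := by norm_cast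
      rw [h1, h2, Real.exp_zero, one_mul]
      gcongr
      exact hh1 x
  have hbound (c : ℝ) (hc : 0 < c) :
      ‖∫ β : ℝ, Complex.exp (-c⁻¹ * ‖β‖ ^ 2) • F β‖ ≤ ∫ w, K c (t - w) * g w := by
    have hKint : Integrable (fun x ↦ K c (t - S x)) μ := by
      refine .of_bound (by fun_prop) (Real.sqrt (Real.pi * c)) (ae_of_all _ fun x ↦ ?_)
      rw [Real.norm_of_nonneg (hK _ _)]
      refine mul_le_of_le_one_right (by positivity) (Real.exp_le_one_iff.2 ?_)
      have : 0 ≤ c * (t - S x) ^ 2 := by positivity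
      linarith
    calc ‖∫ β : ℝ, Complex.exp (-c⁻¹ * ‖β‖ ^ 2) • F β‖ = ‖∫ x, K c (t - S x) * h x ∂μ‖ := by
          rw [key c hc]
      _ ≤ ∫ x, K c (t - S x) ∂μ := by
          refine norm_integral_le_of_norm_le hKint (ae_of_all _ fun x ↦ ?_)
          rw [norm_mul, Complex.norm_of_nonneg (hK _ _)]
          exact mul_le_of_le_one_right (hK _ _) (hh1 x)
      _ = ∫ w, K c (t - w) ∂(μ.map S) := by
          rw [integral_map hS.aemeasurable (by fun_prop)]
      _ = ∫ w, K c (t - w) * g w := by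
          rw [hmap, integral_withDensity_eq_integral_toReal_smul hgm.ennreal_ofReal
            (ae_of_all _ fun _ ↦ ENNReal.ofReal_lt_top)]
          simp [ENNReal.toReal_ofReal (hg0 _), mul_comm]
  have hlim : Filter.Tendsto (fun c ↦ ∫ w, K c (t - w) * g w) Filter.atTop
      (nhds (2 * Real.pi * g t)) := by
    have hgc : Integrable fun w ↦ (g w : ℂ) := hgi.ofReal
    have hsub : Filter.Tendsto (fun c : ℝ ↦ c / (4 * Real.pi ^ 2)) Filter.atTop Filter.atTop :=
      Filter.tendsto_id.atTop_div_const (by positivity)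
    have := ((Real.tendsto_integral_gaussian_smul' hgc (v := t)
      (Complex.continuous_ofReal.continuousAt.comp hgt)).comp hsub).const_mul (2 * Real.pi : ℂ)
    have hre := (Complex.continuous_re.tendsto _).comp this
    refine (hre.congr' ?_).trans_eq ?_
    · filter_upwards [Filter.eventually_gt_atTop 0] with c hc
      have hw (w : ℝ) : (2 * Real.pi : ℂ) * (((Real.pi : ℂ) * ((c / (4 * Real.pi ^ 2) : ℝ) : ℂ)) ^
          (((Module.finrank ℝ ℝ : ℕ) : ℂ) / 2) * Complex.exp (-(Real.pi : ℂ) ^ 2 *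
            ((c / (4 * Real.pi ^ 2) : ℝ) : ℂ) * (‖t - w‖ : ℂ) ^ 2)) • (g w : ℂ) =
          ↑(K c (t - w) * g w) := by
        have hsqrt : Real.sqrt (Real.pi * c) =
            2 * Real.pi * Real.sqrt (Real.pi * (c / (4 * Real.pi ^ 2))) := by
          rw [← Real.sqrt_sq (by positivity : 0 ≤ 2 * Real.pi), ← Real.sqrt_mul (by positivity)]
          congr 1
          field_simp
          ring
        have hnorm : ((‖t - w‖ : ℝ) : ℂ) ^ 2 = (t - w : ℂ) ^ 2 := by
          rw [← Complex.ofReal_pow, Real.norm_eq_abs, sq_abs]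
          push_cast
          rfl
        simp only [K]
        rw [hsqrt, hnorm, Module.finrank_self, Nat.cast_one, Real.sqrt_eq_rpow, smul_eq_mul]
        simp only [Complex.ofReal_mul, Complex.ofReal_exp]
        rw [Complex.ofReal_cpow (by positivity)]
        have hexp : -(Real.pi : ℂ) ^ 2 * ((c / (4 * Real.pi ^ 2) : ℝ) : ℂ) * (t - w : ℂ) ^ 2 =
            ((-c * (t - w) ^ 2 / 4 : ℝ) : ℂ) := by
          push_cast
          field_simp
        rw [hexp]
        push_cast
        ring
      simp only [Function.comp_apply]
      rw [← integral_const_mul]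
      simp_rw [hw]
      rw [integral_complex_ofReal, Complex.ofReal_re]
    · norm_cast
  refine le_of_tendsto_of_tendsto (Real.tendsto_integral_cexp_sq_smul hF).norm hlim ?_
  filter_upwards [Filter.eventually_gt_atTop 0] with c hc
  simpa using hbound c hc

/-- For `ρ > 0` there is a constant `C > 0` such that for every `n ≥ 1`, all reals
`A_1, …, A_n` and all `t > 0`,
`|∫ e^{iβt} ∏_k (1 - i(A_k - β))^{-ρ} dβ| ≤ Cⁿ t^{nρ-1} e^{-t} / ((n-1)!)^ρ`. -/
theorem stmt6 (ρ : ℝ) (hρ : 0 < ρ) :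
    ∃ C : ℝ, 0 < C ∧ ∀ (n : ℕ), 1 ≤ n → ∀ (A : Fin n → ℝ) (t : ℝ), 0 < t →
      ‖∫ β : ℝ, Complex.exp (Complex.I * β * t) *
          ∏ k : Fin n, ((1 : ℂ) - Complex.I * ((A k : ℂ) - (β : ℂ))) ^ (-(ρ : ℂ))‖ ≤
        C ^ n * t ^ ((n : ℝ) * ρ - 1) * Real.exp (-t) / ((n - 1).factorial : ℝ) ^ ρ := by
  set B : ℝ := 2 * (1 + ρ) * (Real.exp 1 / ρ) ^ ρ
  refine ⟨2 * Real.pi * B, by positivity, fun n hn A t ht ↦ ?_⟩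
  have : Nonempty (Fin n) := ⟨⟨0, hn⟩⟩
  have := ProbabilityTheory.isProbabilityMeasure_gammaMeasure hρ one_pos
  have hb : 0 < n * ρ := by positivity
  have hprod (β : ℝ) : ∏ k : Fin n, ((1 : ℂ) - Complex.I * ((A k : ℂ) - (β : ℂ))) ^ (-(ρ : ℂ)) =
      ∫ x : Fin n → ℝ, Complex.exp (-(Complex.I * β * ↑(∑ k, x k))) *
        Complex.exp (Complex.I * ↑(∑ k, A k * x k))
        ∂Measure.pi fun _ ↦ ProbabilityTheory.gammaMeasure ρ 1 := by
    have hk (k : Fin n) : ((1 : ℂ) - Complex.I * ((A k : ℂ) - (β : ℂ))) ^ (-(ρ : ℂ)) =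
        ∫ x : ℝ, Complex.exp (↑(A k - β) * x * Complex.I) ∂ProbabilityTheory.gammaMeasure ρ 1 := by
      rw [← charFun_apply_real, ProbabilityTheory.charFun_gammaMeasure_one hρ, Complex.ofReal_sub]
    simp_rw [hk]
    rw [← integral_fintype_prod_eq_prod
      (fun k (x : ℝ) ↦ Complex.exp (↑(A k - β) * x * Complex.I))]
    congr 1 with x
    rw [← Complex.exp_sum, ← Complex.exp_add]
    congr 1
    push_cast
    rw [Finset.mul_sum, Finset.mul_sum, ← Finset.sum_neg_distrib, ← Finset.sum_add_distrib]
    exact Finset.sum_congr rfl fun k _ ↦ by ring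
  have hpdf : ProbabilityTheory.gammaPDFReal (n * ρ) 1 t =
      t ^ (n * ρ - 1) * Real.exp (-t) / Real.Gamma (n * ρ) := by
    rw [ProbabilityTheory.gammaPDFReal, if_pos ht.le, Real.one_rpow, one_mul]
    ring
  have hcont : ContinuousAt (ProbabilityTheory.gammaPDFReal (n * ρ) 1) t := by
    have : ContinuousAt (fun x : ℝ ↦ 1 ^ (n * ρ) / Real.Gamma (n * ρ) * x ^ (n * ρ - 1) *
        Real.exp (-(1 * x))) t := by
      refine ContinuousAt.mul (continuousAt_const.mul ?_) (by fun_prop)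
      exact Real.continuousAt_rpow_const _ _ (Or.inl ht.ne')
    refine this.congr ?_
    filter_upwards [lt_mem_nhds ht] with x hx
    rw [ProbabilityTheory.gammaPDFReal, if_pos hx.le]
  have hmain := norm_integral_exp_mul_le_of_map_eq_withDensity
    (μ := Measure.pi fun _ : Fin n ↦ ProbabilityTheory.gammaMeasure ρ 1)
    (S := fun x ↦ ∑ k, x k) (h := fun x ↦ Complex.exp (Complex.I * ↑(∑ k, A k * x k)))
    (by fun_prop) (by fun_prop) (fun x ↦ by simp [Complex.norm_exp])
    (ProbabilityTheory.gammaPDFReal_nonneg hb one_pos) (by fun_prop)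
    (ProbabilityTheory.integrable_gammaPDFReal hb one_pos)
    (by rw [ProbabilityTheory.map_sum_pi_gammaMeasure_one hρ, Fintype.card_fin]; rfl) hcont
  simp_rw [hprod]
  refine hmain.trans ?_
  rw [hpdf]
  have hG := Real.Gamma_pos_of_pos hb
  have hf := Real.factorial_rpow_le_pow_mul_Gamma hρ hn
  have hpi : 2 * Real.pi ≤ (2 * Real.pi) ^ n :=
    le_self_pow₀ (by linarith [Real.pi_gt_three]) (by omega)
  have hfac : 0 < ((n - 1).factorial : ℝ) ^ ρ := by positivity
  rw [le_div_iff₀ hfac, mul_pow]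
  calc 2 * Real.pi * (t ^ (n * ρ - 1) * Real.exp (-t) / Real.Gamma (n * ρ)) *
        ((n - 1).factorial : ℝ) ^ ρ
      ≤ (2 * Real.pi) ^ n * (t ^ (n * ρ - 1) * Real.exp (-t) / Real.Gamma (n * ρ)) *
        (B ^ n * Real.Gamma (n * ρ)) := by gcongr
    _ = _ := by field_simp
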